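/- arXiv:2603.19205 — 2 statements merged into one kernel-verified Lean document; each statement's English description precedes it below -/
import Mathlib

section
/- There exist a constant c > 0 and a threshold N₀ such that for every finite abelian group G with |G| = n ≥ N₀, the number of symmetric subsets S ⊆ G³ that are invariant (setwise) under the componentwise action of some non-identity automorphism of G is at most 2^{−cn²}·2^{h(G)}. -/
/-- A subset `S ⊆ G³` is symmetric if it is closed under all permutations of the three
coordinates (swap and cycle generate `S₃`) and under the diagonal left-multiplication
action of `G`. -/
def IsSymmetric {G : Type*} [CommGroup G] (S : Set (G × G × G)) : Prop :=
  (∀ x y z : G, (x, y, z) ∈ S → (y, x, z) ∈ S) ∧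
  (∀ x y z : G, (x, y, z) ∈ S → (y, z, x) ∈ S) ∧
  (∀ g x y z : G, (x, y, z) ∈ S → (g * x, g * y, g * z) ∈ S)

/-- A hexagon of an abelian group `G` is an orbit of `G³` under the combined action of
`G` (diagonal multiplication) and `S₃` (permutation of coordinates).
`hexRel v w` says that `w` lies in the orbit of `v`. -/
def hexRel {G : Type*} [CommGroup G] (v w : G × G × G) : Prop :=
  ∃ g : G, w = (g * v.1, g * v.2.1, g * v.2.2) ∨ w = (g * v.1, g * v.2.2, g * v.2.1) ∨
    w = (g * v.2.1, g * v.1, g * v.2.2) ∨ w = (g * v.2.1, g * v.2.2, g * v.1) ∨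
    w = (g * v.2.2, g * v.1, g * v.2.1) ∨ w = (g * v.2.2, g * v.2.1, g * v.1)

/-- A subset of `G³` is a hexagon if it is the orbit of some triple. -/
def IsHexagon {G : Type*} [CommGroup G] (H : Set (G × G × G)) : Prop :=
  ∃ v : G × G × G, H = {w | hexRel v w}

/-- The number of hexagons of `G`. -/
noncomputable def numHexagons (G : Type*) [CommGroup G] : ℕ :=
  Nat.card {H : Set (G × G × G) // IsHexagon H}

section InvariantSubsets

variable {X : Type*}

/-- A maximal set disjoint from its image under `σ` contains at least a third of the
points moved by `σ`. -/
theorem exists_disjoint_image_card [Fintype X] [DecidableEq X] (σ : X → X)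
    (hσ : Function.Injective σ) :
    ∃ A : Finset X, (∀ x ∈ A, σ x ∉ A) ∧
      (Finset.univ.filter fun x => σ x ≠ x).card ≤ 3 * A.card := by
  obtain ⟨A, hA⟩ := Set.Finite.exists_maximal
    (Set.toFinite {A : Finset X | ∀ x ∈ A, σ x ∉ A}) ⟨∅, by simp⟩
  refine ⟨A, hA.prop, ?_⟩
  have hcover : (Finset.univ.filter fun x => σ x ≠ x) ⊆
      A ∪ (A.image σ ∪ A.preimage σ hσ.injOn) := by
    intro x hx
    simp only [Finset.mem_filter, Finset.mem_univ, true_and] at hx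
    simp only [Finset.mem_union, Finset.mem_image, Finset.mem_preimage]
    by_contra! hcon
    obtain ⟨hxA, himg, hpre⟩ := hcon
    have hins : insert x A ∈ {A : Finset X | ∀ x ∈ A, σ x ∉ A} := by
      intro y hy hσy
      rw [Finset.mem_insert] at hy hσy
      rcases hy with rfl | hy
      · exact hσy.elim hx hpre
      · exact hσy.elim (himg y hy) (hA.prop y hy)
    exact hxA (hA.le_of_ge hins (Finset.subset_insert x A) (Finset.mem_insert_self x A))
  have hpre : (A.preimage σ hσ.injOn).card ≤ A.card :=
    Finset.card_le_card_of_injOn σ (fun x hx => by simpa using hx) hσ.injOn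
  have h₁ := Finset.card_le_card hcover
  have h₂ := Finset.card_union_le A (A.image σ ∪ A.preimage σ hσ.injOn)
  have h₃ := Finset.card_union_le (A.image σ) (A.preimage σ hσ.injOn)
  have h₄ : (A.image σ).card ≤ A.card := Finset.card_image_le
  omega

/-- An invariant set is determined by its trace outside a set disjoint from its image. -/
theorem card_invariant_sets_mul_le [Fintype X] [DecidableEq X] (σ : X → X) (A : Finset X)
    (hA : ∀ x ∈ A, σ x ∉ A) :
    Nat.card {T : Set X // ∀ x, σ x ∈ T ↔ x ∈ T} * 2 ^ A.card ≤ 2 ^ Fintype.card X := by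
  have hinj : Function.Injective
      (fun T : {T : Set X // ∀ x, σ x ∈ T ↔ x ∈ T} =>
        ({x | (x : X) ∈ T.1} : Set {x // x ∉ A})) := by
    rintro ⟨T, hT⟩ ⟨U, hU⟩ h
    have hout : ∀ x, x ∉ A → (x ∈ T ↔ x ∈ U) := fun x hx =>
      Set.ext_iff.mp h ⟨x, hx⟩
    refine Subtype.ext (Set.ext fun x => ?_)
    by_cases hx : x ∈ A
    · exact (hT x).symm.trans ((hout _ (hA x hx)).trans (hU x))
    · exact hout x hx
  have hle := Nat.card_le_card_of_injective _ hinj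
  have hcard : Nat.card (Set {x // x ∉ A}) = 2 ^ (Fintype.card X - A.card) := by
    rw [Nat.card_eq_fintype_card, Fintype.card_set, Fintype.card_subtype_compl]
    simp
  rw [hcard] at hle
  calc _ ≤ 2 ^ (Fintype.card X - A.card) * 2 ^ A.card := Nat.mul_le_mul_right _ hle
    _ = 2 ^ Fintype.card X := by
      rw [← pow_add, Nat.sub_add_cancel (Finset.card_le_univ A)]

end InvariantSubsets

section Hexagons

variable {G : Type*} [CommGroup G]

theorem hexRel_equivalence : Equivalence (hexRel (G := G)) where
  refl v := ⟨1, by simp⟩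
  symm := by
    rintro ⟨x, y, z⟩ _ ⟨g, rfl | rfl | rfl | rfl | rfl | rfl⟩ <;>
      refine ⟨g⁻¹, ?_⟩ <;> simp
  trans := by
    rintro ⟨x, y, z⟩ _ _ ⟨g, rfl | rfl | rfl | rfl | rfl | rfl⟩
      ⟨k, rfl | rfl | rfl | rfl | rfl | rfl⟩ <;>
      refine ⟨k * g, ?_⟩ <;> simp [mul_assoc]

/-- The setoid on triples whose classes are the hexagons. -/
def hexSetoid (G : Type*) [CommGroup G] : Setoid (G × G × G) := ⟨hexRel, hexRel_equivalence⟩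

/-- The componentwise action of an automorphism on triples. -/
def mapTriple (f : G ≃* G) (v : G × G × G) : G × G × G := (f v.1, f v.2.1, f v.2.2)

theorem hexRel.map (f : G ≃* G) {v w : G × G × G} (h : hexRel v w) :
    hexRel (mapTriple f v) (mapTriple f w) := by
  obtain ⟨x, y, z⟩ := v
  obtain ⟨g, rfl | rfl | rfl | rfl | rfl | rfl⟩ := h <;>
    refine ⟨f g, ?_⟩ <;> simp [mapTriple]

theorem hexRel_map_iff (f : G ≃* G) {v w : G × G × G} :
    hexRel (mapTriple f v) (mapTriple f w) ↔ hexRel v w :=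
  ⟨fun h => by simpa [mapTriple] using h.map f.symm, fun h => h.map f⟩

/-- The action of an automorphism on hexagons. -/
def hexMap (f : G ≃* G) : Quotient (hexSetoid G) → Quotient (hexSetoid G) :=
  Quotient.map (mapTriple f) fun _ _ h => hexRel.map f h

theorem hexMap_injective (f : G ≃* G) : Function.Injective (hexMap f) := by
  rintro ⟨v⟩ ⟨w⟩ h
  exact Quotient.sound ((hexRel_map_iff f).mp (Quotient.exact h))

theorem IsSymmetric.mem_of_hexRel {S : Set (G × G × G)} (hS : IsSymmetric S)
    {v w : G × G × G} (h : hexRel v w) (hv : v ∈ S) : w ∈ S := by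
  obtain ⟨x, y, z⟩ := v
  obtain ⟨hswap, hcyc, hmul⟩ := hS
  obtain ⟨g, rfl | rfl | rfl | rfl | rfl | rfl⟩ := h <;> apply hmul
  · exact hv
  · exact hswap _ _ _ (hcyc _ _ _ (hcyc _ _ _ hv))
  · exact hswap _ _ _ hv
  · exact hcyc _ _ _ hv
  · exact hcyc _ _ _ (hcyc _ _ _ hv)
  · exact hswap _ _ _ (hcyc _ _ _ hv)

theorem IsSymmetric.mk_mem_image_iff {S : Set (G × G × G)} (hS : IsSymmetric S)
    (v : G × G × G) : Quotient.mk (hexSetoid G) v ∈ Quotient.mk (hexSetoid G) '' S ↔ v ∈ S :=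
  ⟨fun ⟨_, hw, h⟩ => hS.mem_of_hexRel (Quotient.exact h) hw, fun h => ⟨v, h, rfl⟩⟩

theorem card_hexSetoid_le_numHexagons [Finite G] :
    Nat.card (Quotient (hexSetoid G)) ≤ numHexagons G := by
  refine Nat.card_le_card_of_surjective
    (β := Quotient (hexSetoid G)) (α := {H : Set (G × G × G) // IsHexagon H})
    (fun H => Quotient.mk _ H.2.choose) ?_
  rintro ⟨v⟩
  let H : {H : Set (G × G × G) // IsHexagon H} := ⟨{w | hexRel v w}, v, rfl⟩
  refine ⟨H, Quotient.sound ?_⟩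
  have h : {w | hexRel v w} = {w | hexRel H.2.choose w} := H.2.choose_spec
  exact h.subset (hexRel_equivalence.refl v)

theorem card_symmetric_invariant_le [Finite G] (f : G ≃* G) :
    Nat.card {S : Set (G × G × G) // IsSymmetric S ∧ mapTriple f '' S = S} ≤
      Nat.card {T : Set (Quotient (hexSetoid G)) // ∀ q, hexMap f q ∈ T ↔ q ∈ T} := by
  have hinj : Function.Injective (mapTriple f) := by
    rintro ⟨x, y, z⟩ ⟨x', y', z'⟩ h
    simpa [mapTriple] using h
  refine Nat.card_le_card_of_injective
    (fun S => ⟨Quotient.mk (hexSetoid G) '' S.1, ?_⟩) ?_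
  · rintro ⟨v⟩
    refine (S.2.1.mk_mem_image_iff (mapTriple f v)).trans
      (Iff.trans ?_ (S.2.1.mk_mem_image_iff v).symm)
    conv_lhs => rw [← S.2.2]
    exact hinj.mem_set_image
  · rintro ⟨S, hS, _⟩ ⟨U, hU, _⟩ h
    have h' : Quotient.mk (hexSetoid G) '' S = Quotient.mk (hexSetoid G) '' U :=
      congrArg Subtype.val h
    refine Subtype.ext (Set.ext fun v => ?_)
    rw [← hS.mk_mem_image_iff v, h', hU.mk_mem_image_iff v]

theorem hexRel_one_one_iff {a b c d : G} :
    hexRel (1, a, b) (1, c, d) ↔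
      (c = a ∧ d = b) ∨ (c = b ∧ d = a) ∨ (c = a⁻¹ ∧ d = a⁻¹ * b) ∨
      (c = a⁻¹ * b ∧ d = a⁻¹) ∨ (c = b⁻¹ ∧ d = b⁻¹ * a) ∨ (c = b⁻¹ * a ∧ d = b⁻¹) := by
  constructor
  · rintro ⟨g, h⟩
    simp only [Prod.mk.injEq, mul_one] at h
    rcases h with ⟨h, rfl, rfl⟩ | ⟨h, rfl, rfl⟩ | ⟨h, rfl, rfl⟩ | ⟨h, rfl, rfl⟩ |
      ⟨h, rfl, rfl⟩ | ⟨h, rfl, rfl⟩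
    · simp [← h]
    · simp [← h]
    all_goals
      obtain rfl := eq_inv_of_mul_eq_one_left h.symm
      simp
  · rintro (⟨rfl, rfl⟩ | ⟨rfl, rfl⟩ | ⟨rfl, rfl⟩ | ⟨rfl, rfl⟩ | ⟨rfl, rfl⟩ | ⟨rfl, rfl⟩)
    · exact ⟨1, by simp⟩
    · exact ⟨1, by simp⟩
    · exact ⟨a⁻¹, by simp⟩
    · exact ⟨a⁻¹, by simp⟩
    · exact ⟨b⁻¹, by simp⟩
    · exact ⟨b⁻¹, by simp⟩

theorem two_mul_card_fixed_le [Fintype G] [DecidableEq G] {f : G ≃* G}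
    (hf : f ≠ MulEquiv.refl G) :
    2 * (Finset.univ.filter fun a => f a = a).card ≤ Fintype.card G := by
  let H : Subgroup G := f.toMonoidHom.eqLocus (MonoidHom.id G)
  have hH : H ≠ ⊤ := by
    intro h
    refine hf (MulEquiv.ext fun a => ?_)
    have : a ∈ H := h ▸ Subgroup.mem_top a
    exact this
  have hcard : Nat.card H = (Finset.univ.filter fun a => f a = a).card := by
    rw [← Fintype.card_subtype, ← Nat.card_eq_fintype_card]
    rfl
  rw [← hcard, ← Nat.card_eq_fintype_card, ← H.index_mul_card]
  have hidx : 1 < H.index := Subgroup.one_lt_index_of_ne_top hH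
  exact Nat.mul_le_mul_right _ hidx

open Classical in
/-- Except when `f` fixes both `a` and `b`, if `f` fixes the hexagon of `(1, a, b)` then one of
`a`, `b` determines the other. -/
theorem card_fixed_pairs_le [Fintype G] {f : G ≃* G} (hf : f ≠ MulEquiv.refl G) :
    4 * (Finset.univ.filter fun p : G × G => hexRel (1, p.1, p.2) (1, f p.1, f p.2)).card ≤
      Fintype.card G ^ 2 + 20 * Fintype.card G := by
  let F : Finset G := Finset.univ.filter fun a => f a = a
  let I (t : G → G × G) : Finset (G × G) := Finset.univ.image t
  have hI (t : G → G × G) : (I t).card ≤ Fintype.card G := Finset.card_image_le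
  let t₁ : G → G × G := fun a => (a, f a)
  let t₂ : G → G × G := fun b => (b * (f b)⁻¹, b)
  let t₃ : G → G × G := fun b => ((f b)⁻¹, b)
  let t₄ : G → G × G := fun a => (a, (f a)⁻¹)
  let t₅ : G → G × G := fun a => (a, a * (f a)⁻¹)
  have hcover : (Finset.univ.filter fun p : G × G => hexRel (1, p.1, p.2) (1, f p.1, f p.2)) ⊆
      F ×ˢ F ∪ (I t₁ ∪ (I t₂ ∪ (I t₃ ∪ (I t₄ ∪ I t₅)))) := by
    rintro ⟨a, b⟩ h
    simp only [Finset.mem_filter, Finset.mem_univ, true_and, hexRel_one_one_iff] at h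
    simp only [Finset.mem_union, Finset.mem_product, F, I, t₁, t₂, t₃, t₄, t₅, Finset.mem_filter,
      Finset.mem_univ, true_and, Finset.mem_image, Prod.mk.injEq, exists_eq_left,
      exists_eq_right]
    rcases h with h | ⟨h, -⟩ | ⟨-, h⟩ | ⟨-, h⟩ | ⟨h, -⟩ | ⟨h, -⟩ <;> simp [h]
  have h₀ : (F ×ˢ F).card = F.card * F.card := Finset.card_product F F
  have hF : 2 * F.card ≤ Fintype.card G := two_mul_card_fixed_le hf
  have h := Finset.card_le_card hcover
  have u₁ := Finset.card_union_le (F ×ˢ F) (I t₁ ∪ (I t₂ ∪ (I t₃ ∪ (I t₄ ∪ I t₅))))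
  have u₂ := Finset.card_union_le (I t₁) (I t₂ ∪ (I t₃ ∪ (I t₄ ∪ I t₅)))
  have u₃ := Finset.card_union_le (I t₂) (I t₃ ∪ (I t₄ ∪ I t₅))
  have u₄ := Finset.card_union_le (I t₃) (I t₄ ∪ I t₅)
  have u₅ := Finset.card_union_le (I t₄) (I t₅)
  have hI₁ := hI t₁
  have hI₂ := hI t₂
  have hI₃ := hI t₃
  have hI₄ := hI t₄
  have hI₅ := hI t₅
  have hFF : 4 * (F.card * F.card) ≤ Fintype.card G ^ 2 := by nlinarith
  omega

open Classical in
theorem card_pairs_le_card_moved [Fintype G] {f : G ≃* G} (hf : f ≠ MulEquiv.refl G) :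
    3 * Fintype.card G ^ 2 ≤
      24 * (Finset.univ.filter fun q => hexMap f q ≠ q).card + 20 * Fintype.card G := by
  let φ : G × G → Quotient (hexSetoid G) := fun p => Quotient.mk _ (1, p.1, p.2)
  let P : Finset (G × G) :=
    Finset.univ.filter fun p => ¬ hexRel (1, p.1, p.2) (1, f p.1, f p.2)
  have hmaps : ∀ p ∈ P, φ p ∈ Finset.univ.filter fun q => hexMap f q ≠ q := by
    intro p hp
    simp only [P, Finset.mem_filter, Finset.mem_univ, true_and] at hp ⊢
    intro h
    have h' : hexRel (mapTriple f (1, p.1, p.2)) (1, p.1, p.2) := Quotient.exact h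
    exact hp (by simpa [mapTriple] using hexRel_equivalence.symm h')
  have hfiber : ∀ q ∈ Finset.univ.filter fun q => hexMap f q ≠ q,
      (P.filter fun p => φ p = q).card ≤ 6 := by
    intro q _
    rcases (P.filter fun p => φ p = q).eq_empty_or_nonempty with h | ⟨⟨a, b⟩, hab⟩
    · simp [h]
    have hsub : (P.filter fun p => φ p = q) ⊆
        {(a, b), (b, a), (a⁻¹, a⁻¹ * b), (a⁻¹ * b, a⁻¹), (b⁻¹, b⁻¹ * a), (b⁻¹ * a, b⁻¹)} := by
      rintro ⟨c, d⟩ hcd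
      have h : hexRel (1, a, b) (1, c, d) := Quotient.exact
        ((Finset.mem_filter.mp hab).2.trans (Finset.mem_filter.mp hcd).2.symm)
      simpa using hexRel_one_one_iff.mp h
    exact (Finset.card_le_card hsub).trans Finset.card_le_six
  have h₁ := Finset.card_le_mul_card_image_of_maps_to hmaps 6 hfiber
  have h₂ := card_fixed_pairs_le hf
  have h₃ := Finset.card_filter_add_card_filter_not (s := (Finset.univ : Finset (G × G)))
    (fun p => hexRel (1, p.1, p.2) (1, f p.1, f p.2))
  rw [Finset.card_univ, Fintype.card_prod, ← pow_two] at h₃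
  change _ + P.card = _ at h₃
  omega

theorem card_symmetric_invariant_le_two_rpow [Fintype G] (hG : 20 ≤ Fintype.card G)
    {f : G ≃* G} (hf : f ≠ MulEquiv.refl G) :
    (Nat.card {S : Set (G × G × G) // IsSymmetric S ∧ mapTriple f '' S = S} : ℝ) ≤
      (2 : ℝ) ^ (-((Fintype.card G : ℝ) ^ 2 / 36)) * 2 ^ numHexagons G := by
  classical
  obtain ⟨A, hA, hcard⟩ := exists_disjoint_image_card (hexMap f) (hexMap_injective f)
  have hmoved := card_pairs_le_card_moved hf
  have hAcard : Fintype.card G ^ 2 ≤ 36 * A.card := by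
    have : 20 * Fintype.card G ≤ Fintype.card G ^ 2 := by nlinarith
    have hcard' : (Finset.univ.filter fun q => hexMap f q ≠ q).card ≤ 3 * A.card := by
      convert hcard
    omega
  have hmul : Nat.card {S : Set (G × G × G) // IsSymmetric S ∧ mapTriple f '' S = S} *
      2 ^ A.card ≤ 2 ^ numHexagons G :=
    calc _ ≤ _ := Nat.mul_le_mul_right _ (card_symmetric_invariant_le f)
      _ ≤ _ := card_invariant_sets_mul_le _ A hA
      _ ≤ _ := Nat.pow_le_pow_right two_pos
        (Nat.card_eq_fintype_card (α := Quotient (hexSetoid G)) ▸ card_hexSetoid_le_numHexagons)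
  have hmul' : (Nat.card {S : Set (G × G × G) // IsSymmetric S ∧ mapTriple f '' S = S} : ℝ) *
      2 ^ A.card ≤ 2 ^ numHexagons G := by exact_mod_cast hmul
  rw [Real.rpow_neg two_pos.le, ← div_eq_inv_mul, le_div_iff₀ (by positivity)]
  refine le_trans (mul_le_mul_of_nonneg_left ?_ (Nat.cast_nonneg _)) hmul'
  rw [← Real.rpow_natCast 2 A.card]
  refine Real.rpow_le_rpow_of_exponent_le one_le_two ?_
  have : (Fintype.card G : ℝ) ^ 2 ≤ 36 * A.card := by exact_mod_cast hAcard
  linarith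

theorem card_mulEquiv_le [Fintype G] :
    Nat.card {f : G ≃* G // f ≠ MulEquiv.refl G} ≤ Fintype.card G ^ Fintype.card G := by
  classical
  rw [← Fintype.card_fun, ← Nat.card_eq_fintype_card]
  exact Nat.card_le_card_of_injective (fun f => (f.1 : G → G))
    fun f g h => Subtype.ext (DFunLike.coe_injective h)

theorem card_symmetric_nontrivially_invariant_le [Fintype G] (hG : 20 ≤ Fintype.card G) :
    (Nat.card {S : Set (G × G × G) // IsSymmetric S ∧ ∃ f : G ≃* G,
        f ≠ MulEquiv.refl G ∧ mapTriple f '' S = S} : ℝ) ≤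
      (Fintype.card G : ℝ) ^ Fintype.card G *
        ((2 : ℝ) ^ (-((Fintype.card G : ℝ) ^ 2 / 36)) * 2 ^ numHexagons G) := by
  classical
  let E (f : {f : G ≃* G // f ≠ MulEquiv.refl G}) : Type _ :=
    {S : Set (G × G × G) // IsSymmetric S ∧ mapTriple f.1 '' S = S}
  have hle : Nat.card {S : Set (G × G × G) // IsSymmetric S ∧ ∃ f : G ≃* G,
      f ≠ MulEquiv.refl G ∧ mapTriple f '' S = S} ≤ Nat.card (Σ f, E f) :=
    Nat.card_le_card_of_surjective
      (fun p : Σ f, E f => ⟨p.2.1, p.2.2.1, p.1.1, p.1.2, p.2.2.2⟩)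
      fun ⟨S, hS, f, hf, hfS⟩ => ⟨⟨⟨f, hf⟩, S, hS, hfS⟩, rfl⟩
  have : Fintype {f : G ≃* G // f ≠ MulEquiv.refl G} := Fintype.ofFinite _
  rw [Nat.card_sigma] at hle
  calc _ ≤ ((∑ f, Nat.card (E f) : ℕ) : ℝ) := by exact_mod_cast hle
    _ = ∑ f, (Nat.card (E f) : ℝ) := by push_cast; rfl
    _ ≤ Finset.univ.card •
        ((2 : ℝ) ^ (-((Fintype.card G : ℝ) ^ 2 / 36)) * 2 ^ numHexagons G) :=
      Finset.sum_le_card_nsmul _ _ _ fun f _ => card_symmetric_invariant_le_two_rpow hG f.2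
    _ ≤ _ := by
      rw [nsmul_eq_mul]
      refine mul_le_mul_of_nonneg_right ?_ (by positivity)
      rw [Finset.card_univ, ← Nat.card_eq_fintype_card]
      exact_mod_cast card_mulEquiv_le

end Hexagons

theorem exists_forall_le_two_rpow {ε : ℝ} (hε : 0 < ε) :
    ∃ N : ℕ, ∀ n : ℕ, N ≤ n → (n : ℝ) ≤ (2 : ℝ) ^ (ε * n) := by
  have h := tendsto_pow_const_div_const_pow_of_one_lt 1
    (Real.one_lt_rpow one_lt_two hε)
  obtain ⟨N, hN⟩ := Filter.eventually_atTop.mp (h.eventually_le_const one_pos)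
  refine ⟨N, fun n hn => ?_⟩
  have hbound := hN n hn
  rwa [pow_one, div_le_one (by positivity), ← Real.rpow_mul_natCast two_pos.le] at hbound

/-- there are `c > 0` and `N₀` such that for every finite abelian group `G`
of order `n ≥ N₀`, the number of symmetric subsets of `G³` invariant (setwise) under the
componentwise action of some non-identity automorphism of `G` is at most
`2^{-cn²} · 2^{h(G)}`. -/
theorem stmt9 :
    ∃ c : ℝ, 0 < c ∧ ∃ N₀ : ℕ, ∀ (G : Type) [CommGroup G] [Fintype G],
      N₀ ≤ Fintype.card G →
      (Nat.card {S : Set (G × G × G) // IsSymmetric S ∧ ∃ f : G ≃* G,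
          f ≠ MulEquiv.refl G ∧
          (fun v : G × G × G => (f v.1, f v.2.1, f v.2.2)) '' S = S} : ℝ) ≤
        (2 : ℝ) ^ (-(c * (Fintype.card G : ℝ) ^ 2)) * 2 ^ numHexagons G := by
  obtain ⟨N, hN⟩ := exists_forall_le_two_rpow (ε := 1 / 72) (by norm_num)
  refine ⟨1 / 72, by norm_num, max N 20, fun G _ _ hG => ?_⟩
  refine (card_symmetric_nontrivially_invariant_le (le_of_max_le_right hG)).trans ?_
  rw [← mul_assoc]
  refine mul_le_mul_of_nonneg_right ?_ (by positivity)
  have hpow : (Fintype.card G : ℝ) ^ Fintype.card G ≤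
      (2 : ℝ) ^ ((Fintype.card G : ℝ) ^ 2 / 72) := by
    refine (pow_le_pow_left₀ (Nat.cast_nonneg _) (hN _ (le_of_max_le_left hG)) _).trans_eq ?_
    rw [← Real.rpow_mul_natCast two_pos.le]
    congr 1
    ring
  refine (mul_le_mul_of_nonneg_right hpow (by positivity)).trans_eq ?_
  rw [← Real.rpow_add two_pos]
  congr 1
  ring
end

section
/- There exist a constant c > 0 and a threshold N₀ such that for every finite abelian group G with |G| = n ≥ N₀ and every ε ∈ G with ε² = 1, the number of symmetric subsets of G³ that are hyperfield-defining with respect to ε is at least (1 − e^{−cn})·2^{h(G)}. In other words, asymptotically almost every pasture on (G, ε) is a hyperfield. -/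
/-- Condition (A) w.r.t. `ε`. -/
def CondA {G : Type*} [CommGroup G] (ε : G) (S : Set (G × G × G)) : Prop :=
  ∀ x : G, x ≠ ε → ∃ y : G, (x, y, 1) ∈ S

/-- Condition (B) w.r.t. `ε`. -/
def CondB {G : Type*} [CommGroup G] (ε : G) (S : Set (G × G × G)) : Prop :=
  ∀ x y z w : G, (x, y, 1) ∈ S → (z, w, 1) ∈ S → (x, y) ≠ (z, w) →
    ∃ t : G, (t * x, ε * t * z, 1) ∈ S ∧ (ε * t * y, t * w, 1) ∈ S

section Counting

open Finset
open scoped Classical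

/-- Requiring every one of the pairs `{f t, g t}`, `t ∈ T`, not to be contained in a subset `A`
of `Q` cuts the number of admissible `A` by a factor `3/4` for each pair, if the pairs are
disjoint. -/
lemma four_pow_mul_card_avoiding_le {ι Q : Type*} [Fintype Q] (f g : ι → Q) (T : Finset ι)
    (hT : ∀ s ∈ T, ∀ t ∈ T, s ≠ t → f s ≠ f t ∧ f s ≠ g t ∧ g s ≠ f t ∧ g s ≠ g t) :
    4 ^ #T * #{A : Finset Q | ∀ t ∈ T, ¬(f t ∈ A ∧ g t ∈ A)} ≤
      3 ^ #T * 2 ^ Fintype.card Q := by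
  induction T using Finset.induction_on with
  | empty => simp
  | insert a T ha ih =>
    have ih' := ih fun s hs t ht => hT s (mem_insert_of_mem hs) t (mem_insert_of_mem ht)
    set B : Finset (Finset Q) := {A | ∀ t ∈ T, ¬(f t ∈ A ∧ g t ∈ A)} with hB
    set B' : Finset (Finset Q) := {A | ∀ t ∈ insert a T, ¬(f t ∈ A ∧ g t ∈ A)} with hB'
    have hsub : B' ⊆ B := fun A hA => by
      simp only [hB, hB', mem_filter, mem_univ, true_and] at hA ⊢
      exact fun t ht => hA t (mem_insert_of_mem ht)
    set u : Finset Q := {f a, g a} with hu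
    have himage : B.image (· ∪ u) ⊆ B \ B' := by
      intro A' hA'
      obtain ⟨A, hA, rfl⟩ := mem_image.1 hA'
      simp only [hB, hB', mem_filter, mem_univ, true_and, mem_sdiff] at hA ⊢
      refine ⟨fun t ht => ?_, fun h => h a (mem_insert_self a T) (by simp [hu])⟩
      have hne : t ≠ a := fun h => ha (h ▸ ht)
      obtain ⟨h1, h2, h3, h4⟩ := hT t (mem_insert_of_mem ht) a (mem_insert_self a T) hne
      simpa [hu, h1, h2, h3, h4] using hA t ht
    have hfibre : ∀ A' ∈ B.image (· ∪ u), #{A ∈ B | A ∪ u = A'} ≤ 4 := by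
      intro A' _
      have hu4 : #u.powerset ≤ 4 := by
        rw [card_powerset]
        exact (Nat.pow_le_pow_right two_pos card_le_two : 2 ^ #u ≤ 2 ^ 2)
      refine (card_le_card_of_injOn (· ∩ u) (fun A _ => ?_) ?_).trans hu4
      · simp
      · intro A hA C hC h
        have hA := (mem_filter.1 hA).2
        have hC := (mem_filter.1 hC).2
        ext q
        have h1 : q ∈ A ∪ u ↔ q ∈ C ∪ u := by rw [hA, hC]
        have h2 : q ∈ A ∩ u ↔ q ∈ C ∩ u := by rw [show A ∩ u = C ∩ u from h]
        simp only [mem_union, mem_inter] at h1 h2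
        tauto
    have h1 := card_le_mul_card_image B 4 hfibre
    have h2 := card_le_card himage
    rw [card_sdiff_of_subset hsub] at h2
    have h3 := card_le_card hsub
    have h4 : 4 * #B' ≤ 3 * #B := by omega
    rw [card_insert_of_notMem ha, pow_succ, pow_succ]
    calc 4 ^ #T * 4 * #B' = 4 ^ #T * (4 * #B') := by ring
      _ ≤ 4 ^ #T * (3 * #B) := by gcongr
      _ = 3 * (4 ^ #T * #B) := by ring
      _ ≤ 3 * (3 ^ #T * 2 ^ Fintype.card Q) := by gcongr
      _ = 3 ^ #T * 3 * 2 ^ Fintype.card Q := by ring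

/-- A reflexive relation on a finite type whose sections have at most `d` elements
has an independent set containing at least a `1/d` fraction of the type. -/
lemma exists_large_independent {ι : Type*} [Fintype ι] (r : ι → ι → Prop)
    (hrefl : ∀ s, r s s) (hsymm : ∀ s t, r s t → r t s) (d : ℕ)
    (hd : ∀ s, #{t | r s t} ≤ d) :
    ∃ T : Finset ι, Fintype.card ι ≤ #T * d ∧ ∀ s ∈ T, ∀ t ∈ T, s ≠ t → ¬ r s t := by
  obtain ⟨T, hT, hmax⟩ := exists_max_image
    ({T | ∀ s ∈ T, ∀ t ∈ T, s ≠ t → ¬ r s t} : Finset (Finset ι)) card ⟨∅, by simp⟩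
  simp only [mem_filter, mem_univ, true_and] at hT hmax
  refine ⟨T, ?_, hT⟩
  have hcover : univ ⊆ T.biUnion fun s => {t | r s t} := by
    intro a _
    simp only [mem_biUnion, mem_filter, mem_univ, true_and]
    by_contra! hne
    have ha : a ∉ T := fun h => hne a h (hrefl a)
    have := hmax (insert a T) (by
      intro s hs t ht hst
      rcases mem_insert.1 hs with rfl | hs' <;> rcases mem_insert.1 ht with rfl | ht'
      · exact absurd rfl hst
      · exact fun h => hne t ht' (hsymm _ _ h)
      · exact hne s hs'
      · exact hT s hs' t ht' hst)
    rw [card_insert_of_notMem ha] at this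
    omega
  exact (card_le_card hcover).trans (card_biUnion_le_card_mul _ _ _ fun s _ => hd s)

end Counting

section Hexagons

open Finset
open scoped Classical

variable {G : Type*} [CommGroup G]

/-- The hexagon of a triple. -/
def hexagonOf (v : G × G × G) : {H : Set (G × G × G) // IsHexagon H} :=
  ⟨{w | hexRel v w}, v, rfl⟩

lemma hexagonOf_surjective : Function.Surjective (hexagonOf (G := G)) := by
  rintro ⟨H, v, rfl⟩
  exact ⟨v, rfl⟩

lemma hexRel_of_hexagonOf_eq {v w : G × G × G} (h : hexagonOf v = hexagonOf w) :
    hexRel v w := by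
  have hw : w ∈ (hexagonOf w).1 := ⟨1, by simp⟩
  rwa [← h] at hw

lemma hexagonOf_swap (x y z : G) : hexagonOf (y, x, z) = hexagonOf (x, y, z) := by
  refine Subtype.ext (Set.ext fun w => exists_congr fun g => ?_)
  dsimp only
  tauto

lemma hexagonOf_rotate (x y z : G) : hexagonOf (y, z, x) = hexagonOf (x, y, z) := by
  refine Subtype.ext (Set.ext fun w => exists_congr fun g => ?_)
  dsimp only
  tauto

lemma hexagonOf_mul (g x y z : G) :
    hexagonOf (g * x, g * y, g * z) = hexagonOf (x, y, z) := by
  refine Subtype.ext (Set.ext fun w => ?_)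
  simp only [hexagonOf, hexRel, Set.mem_ofPred_eq, ← mul_assoc]
  constructor
  · rintro ⟨k, hk⟩
    exact ⟨k * g, hk⟩
  · rintro ⟨k, hk⟩
    exact ⟨k * g⁻¹, by simpa using hk⟩

lemma isSymmetric_preimage_hexagonOf (A : Set {H : Set (G × G × G) // IsHexagon H}) :
    IsSymmetric (hexagonOf ⁻¹' A) := by
  refine ⟨fun x y z h => ?_, fun x y z h => ?_, fun g x y z h => ?_⟩
  · rwa [Set.mem_preimage, hexagonOf_swap]
  · rwa [Set.mem_preimage, hexagonOf_rotate]
  · rwa [Set.mem_preimage, hexagonOf_mul]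

/-- Any two lines in the direction of the third coordinate have points of `S` at a common
height. -/
def HasCommonHeights (S : Set (G × G × G)) : Prop :=
  ∀ a b c d : G, ∃ s : G, (a, b, s) ∈ S ∧ (c, d, s) ∈ S

lemma HasCommonHeights.condA {S : Set (G × G × G)} (h : HasCommonHeights S)
    (hS : IsSymmetric S) (ε : G) : CondA ε S := by
  intro x _
  obtain ⟨s, hs, -⟩ := h 1 x 1 x
  exact ⟨s, hS.2.1 _ _ _ hs⟩

lemma HasCommonHeights.condB {S : Set (G × G × G)} (h : HasCommonHeights S)
    (hS : IsSymmetric S) (ε : G) : CondB ε S := by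
  intro x y z w _ _ _
  obtain ⟨s, h1, h2⟩ := h x (ε * z) (ε * y) w
  refine ⟨s⁻¹, ?_, ?_⟩
  · have := hS.2.2 s⁻¹ _ _ _ h1
    rwa [inv_mul_cancel, mul_left_comm, ← mul_assoc] at this
  · have := hS.2.2 s⁻¹ _ _ _ h2
    rwa [inv_mul_cancel, mul_left_comm, ← mul_assoc] at this

variable [Fintype G]

lemma card_hexagonOf_eq_le (a b s c d : G) :
    #{t | hexagonOf (a, b, s) = hexagonOf (c, d, t)} ≤ 6 := by
  have hsub : ({t | hexagonOf (a, b, s) = hexagonOf (c, d, t)} : Finset G) ⊆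
      {c * a⁻¹ * s, c * a⁻¹ * b, c * b⁻¹ * s, c * b⁻¹ * a, c * s⁻¹ * a, c * s⁻¹ * b} := by
    intro t ht
    obtain ⟨g, hg⟩ := hexRel_of_hexagonOf_eq (mem_filter.1 ht).2
    simp only [Prod.mk.injEq] at hg
    rcases hg with ⟨rfl, -, rfl⟩ | ⟨rfl, -, rfl⟩ | ⟨rfl, -, rfl⟩ | ⟨rfl, -, rfl⟩ |
      ⟨rfl, -, rfl⟩ | ⟨rfl, -, rfl⟩ <;> simp
  exact (card_le_card hsub).trans card_le_six

/-- Few sets of hexagons miss, at every height, one of two given lines. -/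
lemma exists_four_pow_mul_card_no_common_height_le (a b c d : G) :
    ∃ m : ℕ, Fintype.card G ≤ m * 24 ∧
      4 ^ m * #{A : Finset {H : Set (G × G × G) // IsHexagon H} |
        ∀ s, ¬(hexagonOf (a, b, s) ∈ A ∧ hexagonOf (c, d, s) ∈ A)} ≤
      3 ^ m * 2 ^ numHexagons G := by
  let f : G → {H : Set (G × G × G) // IsHexagon H} := fun s => hexagonOf (a, b, s)
  let g : G → {H : Set (G × G × G) // IsHexagon H} := fun s => hexagonOf (c, d, s)
  obtain ⟨T, hcard, hT⟩ := exists_large_independent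
    (fun s t => f s = f t ∨ f s = g t ∨ g s = f t ∨ g s = g t) (fun s => Or.inl rfl)
    (fun s t h => by simp only [eq_comm (a := f t), eq_comm (a := g t)]; tauto) 24 (by
      intro s
      have h1 : #{t | f s = f t} ≤ 6 := card_hexagonOf_eq_le a b s a b
      have h2 : #{t | f s = g t} ≤ 6 := card_hexagonOf_eq_le a b s c d
      have h3 : #{t | g s = f t} ≤ 6 := card_hexagonOf_eq_le c d s a b
      have h4 : #{t | g s = g t} ≤ 6 := card_hexagonOf_eq_le c d s c d
      refine (card_le_card (t := (univ.filter (f s = f ·) ∪ univ.filter (f s = g ·)) ∪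
        (univ.filter (g s = f ·) ∪ univ.filter (g s = g ·))) fun t ht => ?_).trans ?_
      · simp only [mem_union, mem_filter, mem_univ, true_and] at ht ⊢
        tauto
      · grw [card_union_le, card_union_le, card_union_le, h1, h2, h3, h4])
  refine ⟨#T, hcard, ?_⟩
  have h := four_pow_mul_card_avoiding_le f g T fun s hs t ht hst => by
    simpa only [not_or] using hT s hs t ht hst
  rw [numHexagons, Nat.card_eq_fintype_card]
  refine le_trans ?_ h
  refine Nat.mul_le_mul_left _ (card_le_card fun A hA => ?_)
  simp only [mem_filter, mem_univ, true_and] at hA ⊢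
  exact fun t _ => hA t

/-- The exponential rate of the probability that two given lines have no common height. -/
noncomputable def missRate : ℝ := Real.log (4 / 3) / 24

lemma missRate_pos : 0 < missRate :=
  div_pos (Real.log_pos (by norm_num)) (by norm_num)

lemma card_no_common_height_le (a b c d : G) :
    (#{A : Finset {H : Set (G × G × G) // IsHexagon H} |
        ∀ s, ¬(hexagonOf (a, b, s) ∈ A ∧ hexagonOf (c, d, s) ∈ A)} : ℝ) ≤
      Real.exp (-(missRate * Fintype.card G)) * 2 ^ numHexagons G := by
  obtain ⟨m, hm, h⟩ := exists_four_pow_mul_card_no_common_height_le a b c d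
  set N := #{A : Finset {H : Set (G × G × G) // IsHexagon H} |
        ∀ s, ¬(hexagonOf (a, b, s) ∈ A ∧ hexagonOf (c, d, s) ∈ A)}
  have h' : (4 : ℝ) ^ m * N ≤ 3 ^ m * 2 ^ numHexagons G := by exact_mod_cast h
  have hm' : (Fintype.card G : ℝ) ≤ m * 24 := by exact_mod_cast hm
  have hpow : (3 / 4 : ℝ) ^ m ≤ Real.exp (-(missRate * Fintype.card G)) := by
    have hlog : Real.log (3 / 4) = -(missRate * 24) := by
      rw [missRate, div_mul_cancel₀ _ (by norm_num), ← Real.log_inv]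
      norm_num
    rw [← Real.exp_log (show (0 : ℝ) < 3 / 4 by norm_num), ← Real.exp_nat_mul, hlog,
      Real.exp_le_exp]
    nlinarith [missRate_pos]
  calc (N : ℝ) ≤ (3 / 4) ^ m * 2 ^ numHexagons G := by
        rw [div_pow, div_mul_eq_mul_div, le_div_iff₀ (by positivity)]
        linarith
    _ ≤ _ := by gcongr

lemma card_not_hasCommonHeights_le :
    (#{A : Finset {H : Set (G × G × G) // IsHexagon H} |
        ¬ HasCommonHeights (hexagonOf ⁻¹' (A : Set {H : Set (G × G × G) // IsHexagon H}))} : ℝ) ≤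
      (Fintype.card G : ℝ) ^ 4 *
        (Real.exp (-(missRate * Fintype.card G)) * 2 ^ numHexagons G) := by
  let bad : G × G × G × G → Finset (Finset {H : Set (G × G × G) // IsHexagon H}) := fun p =>
    {A | ∀ s, ¬(hexagonOf (p.1, p.2.1, s) ∈ A ∧ hexagonOf (p.2.2.1, p.2.2.2, s) ∈ A)}
  have hsub : ({A : Finset {H : Set (G × G × G) // IsHexagon H} |
      ¬ HasCommonHeights (hexagonOf ⁻¹' (A : Set {H : Set (G × G × G) // IsHexagon H}))} : Finset _) ⊆ univ.biUnion bad := by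
    intro A hA
    simp only [HasCommonHeights, mem_filter, mem_univ, true_and, not_forall, not_exists] at hA
    obtain ⟨a, b, c, d, h⟩ := hA
    exact mem_biUnion.2 ⟨(a, b, c, d), mem_univ _, mem_filter.2 ⟨mem_univ _, h⟩⟩
  have hle : (#(univ.biUnion bad) : ℝ) ≤ ∑ p, (#(bad p) : ℝ) := by
    exact_mod_cast card_biUnion_le
  refine (Nat.cast_le.2 (card_le_card hsub)).trans (hle.trans ?_)
  refine (sum_le_card_nsmul _ _ _ fun p _ =>
    card_no_common_height_le p.1 p.2.1 p.2.2.1 p.2.2.2).trans_eq ?_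
  simp only [card_univ, Fintype.card_prod, nsmul_eq_mul, Nat.cast_mul]
  ring

lemma card_hasCommonHeights_le (ε : G) :
    #{A : Finset {H : Set (G × G × G) // IsHexagon H} |
        HasCommonHeights (hexagonOf ⁻¹' (A : Set {H : Set (G × G × G) // IsHexagon H}))} ≤
      Nat.card {S : Set (G × G × G) // IsSymmetric S ∧ CondA ε S ∧ CondB ε S} := by
  rw [← Fintype.card_coe, ← Nat.card_eq_fintype_card]
  refine Nat.card_le_card_of_injective (fun A => ⟨hexagonOf ⁻¹' (A.1 : Set {H : Set (G × G × G) // IsHexagon H}), ?_⟩) ?_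
  · have hS := isSymmetric_preimage_hexagonOf (A.1 : Set {H : Set (G × G × G) // IsHexagon H})
    have h := (mem_filter.1 A.2).2
    exact ⟨hS, h.condA hS ε, h.condB hS ε⟩
  · intro A B h
    exact Subtype.ext (coe_injective
      (hexagonOf_surjective.preimage_injective (congrArg Subtype.val h)))

end Hexagons

/-- there are `c > 0` and `N₀` such that for every finite abelian group `G`
of order `n ≥ N₀` and every `ε ∈ G` with `ε² = 1`, the number of symmetric subsets of
`G³` that are hyperfield-defining with respect to `ε` (i.e. satisfy (A) and (B)) is at
least `(1 - e^{-cn}) · 2^{h(G)}`. -/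
theorem stmt15 :
    ∃ c : ℝ, 0 < c ∧ ∃ N₀ : ℕ, ∀ (G : Type) [CommGroup G] [Fintype G],
      N₀ ≤ Fintype.card G → ∀ ε : G, ε ^ 2 = 1 →
      (1 - Real.exp (-(c * Fintype.card G))) * 2 ^ numHexagons G ≤
        (Nat.card {S : Set (G × G × G) // IsSymmetric S ∧ CondA ε S ∧ CondB ε S} : ℝ) := by
  have hr := missRate_pos
  have hev : ∀ᶠ x : ℝ in Filter.atTop, x ^ 4 ≤ Real.exp (missRate / 2 * x) := by
    filter_upwards [(isLittleO_pow_exp_pos_mul_atTop 4 (half_pos hr)).bound one_pos] with x hx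
    rw [one_mul, Real.norm_of_nonneg (Real.exp_pos _).le] at hx
    exact (le_abs_self _).trans hx
  obtain ⟨N₀, hN₀⟩ := Filter.eventually_atTop.1 (tendsto_natCast_atTop_atTop.eventually hev)
  refine ⟨missRate / 2, half_pos hr, N₀, fun G _ _ hG ε _ => ?_⟩
  classical
  have hgood := (Nat.cast_le (α := ℝ)).2 (card_hasCommonHeights_le ε)
  have hbad := card_not_hasCommonHeights_le (G := G)
  have hsplit := Finset.card_filter_add_card_filter_not
    (s := (Finset.univ : Finset (Finset {H : Set (G × G × G) // IsHexagon H})))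
    (fun A => HasCommonHeights (hexagonOf ⁻¹' (A : Set {H : Set (G × G × G) // IsHexagon H})))
  rw [Finset.card_univ, Fintype.card_finset, ← Nat.card_eq_fintype_card] at hsplit
  change _ = 2 ^ numHexagons G at hsplit
  have hsplit' := congrArg (Nat.cast (R := ℝ)) hsplit
  push_cast at hsplit'
  have hexp : (Fintype.card G : ℝ) ^ 4 * Real.exp (-(missRate * Fintype.card G)) ≤
      Real.exp (-(missRate / 2 * Fintype.card G)) := by
    calc _ ≤ Real.exp (missRate / 2 * Fintype.card G) *
          Real.exp (-(missRate * Fintype.card G)) := by gcongr; exact hN₀ _ hG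
      _ = _ := by rw [← Real.exp_add]; ring_nf
  have hmul := mul_le_mul_of_nonneg_right hexp
    (show (0 : ℝ) ≤ 2 ^ numHexagons G by positivity)
  linarith
end
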